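/- arXiv:2604.20984 — 3 statements merged into one kernel-verified Lean document; each statement's English description precedes it below -/
import Mathlib

section
/- Let p ∈ [1,∞], T > 0, and let W be a graphon (measurable, symmetric, nonnegative, W ∈ L¹((0,1)²), with degree d_W(x) = ∫₀¹ W(x,y) dy ≤ 1 for a.e. x). If u ∈ C¹([0,T]; L^p((0,1))) is a classical solution of the graphon diffusion equation ∂u/∂t = ℒ^W u with initial condition u(·,0) = u₀ ∈ L^p((0,1)), then sup_{t ∈ [0,T]} ‖u(·,t)‖_{L^p} ≤ ‖u₀‖_{L^p}. -/
open MeasureTheory Set ENNReal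

/-- Lebesgue measure restricted to the interval (0,1). -/
noncomputable def mu01 : Measure ℝ := volume.restrict (Set.Ioo 0 1)

/-- A graphon: a measurable, symmetric, nonnegative kernel in L^1((0,1)^2)
whose degree function is bounded by 1 a.e. -/
def IsGraphon (W : ℝ → ℝ → ℝ) : Prop :=
  Measurable (Function.uncurry W) ∧
  (∀ x y, W x y = W y x) ∧
  (∀ x y, 0 ≤ W x y) ∧
  Integrable (Function.uncurry W) (mu01.prod mu01) ∧
  (∀ᵐ x ∂mu01, (∫ y, W x y ∂mu01) ≤ 1)

/-- The graphon diffusion operator (graphon Laplacian)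
`ℒ^W u (x) = ∫₀¹ W x y (u y - u x) dy`. -/
noncomputable def graphonLap (W : ℝ → ℝ → ℝ) (u : ℝ → ℝ) : ℝ → ℝ :=
  fun x => ∫ y, W x y * (u y - u x) ∂mu01
lemma gd_pointwise (W : ℝ → ℝ → ℝ) (hW : IsGraphon W) (f : ℝ → ℝ) (hf : StronglyMeasurable f) (x : ℝ)
    (hi : Integrable (W x) mu01) (hd : (∫ y, W x y ∂mu01) ≤ 1) :
    ‖f x + graphonLap W f x‖ₑ ≤ (∫⁻ y, ENNReal.ofReal (W x y) * ‖f y‖ₑ ∂mu01) +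
      (1 - ∫⁻ y, ENNReal.ofReal (W x y) ∂mu01) * ‖f x‖ₑ := by
  obtain ⟨hm, -, hnn, -, -⟩ := hW
  have hWm : Measurable (W x) := hm.of_uncurry_left
  have hE : ∀ y, ENNReal.ofReal (W x y) * ‖f y‖ₑ = ‖W x y * f y‖ₑ := by
    intro y
    rw [enorm_mul, Real.enorm_of_nonneg (hnn x y)]
  have hD : (∫⁻ y, ENNReal.ofReal (W x y) ∂mu01) = ENNReal.ofReal (∫ y, W x y ∂mu01) :=
    (ofReal_integral_eq_lintegral_ofReal hi (Filter.Eventually.of_forall (hnn x))).symm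
  simp_rw [hE]
  rw [hD]
  by_cases h : Integrable (fun y => W x y * f y) mu01
  · have : f x + graphonLap W f x = (∫ y, W x y * f y ∂mu01) + (1 - ∫ y, W x y ∂mu01) * f x := by
      unfold graphonLap
      simp_rw [mul_sub]
      rw [integral_sub h (hi.mul_const _), integral_mul_const]
      ring
    rw [this]
    refine (enorm_add_le _ _).trans (add_le_add (enorm_integral_le_lintegral_enorm _) ?_)
    rw [enorm_mul, Real.enorm_of_nonneg (by linarith : (0:ℝ) ≤ 1 - ∫ y, W x y ∂mu01),
      ENNReal.ofReal_sub _ (integral_nonneg (hnn x)), ENNReal.ofReal_one]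
  · have : ∫⁻ y, ‖W x y * f y‖ₑ ∂mu01 = ⊤ := by
      by_contra hne
      exact h ⟨(hWm.mul hf.measurable).aestronglyMeasurable, lt_top_iff_ne_top.2 hne⟩
    rw [this]
    simp

/-- averaging measure -/
noncomputable def gdNu (W : ℝ → ℝ → ℝ) (x : ℝ) : Measure ℝ :=
  mu01.withDensity (fun y => ENNReal.ofReal (W x y)) +
    (1 - ∫⁻ y, ENNReal.ofReal (W x y) ∂mu01) • Measure.dirac x

lemma gdNu_lintegral (W : ℝ → ℝ → ℝ) (hW : Measurable (Function.uncurry W)) (x : ℝ)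
    (F : ℝ → ℝ≥0∞) (hF : Measurable F) :
    ∫⁻ y, F y ∂(gdNu W x) = (∫⁻ y, ENNReal.ofReal (W x y) * F y ∂mu01) +
      (1 - ∫⁻ y, ENNReal.ofReal (W x y) ∂mu01) * F x := by
  have hWm : Measurable (W x) := hW.of_uncurry_left
  rw [gdNu, lintegral_add_measure, lintegral_smul_measure, lintegral_dirac' _ hF,
    lintegral_withDensity_eq_lintegral_mul _ hWm.ennreal_ofReal hF]
  rfl

lemma gdNu_prob (W : ℝ → ℝ → ℝ) (x : ℝ) 
    (hD : ∫⁻ y, ENNReal.ofReal (W x y) ∂mu01 ≤ 1) : IsProbabilityMeasure (gdNu W x) := by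
  constructor
  simp [gdNu, hD]

lemma gd_contract (p : ℝ≥0∞) [hp : Fact (1 ≤ p)]
    (W : ℝ → ℝ → ℝ) (hW : IsGraphon W)
    (L : Lp ℝ p mu01 →L[ℝ] Lp ℝ p mu01)
    (hL : ∀ f : Lp ℝ p mu01, (L f : ℝ → ℝ) =ᵐ[mu01] graphonLap W f) (f : Lp ℝ p mu01) :
    ‖f + L f‖ ≤ ‖f‖ := by
  haveI : SFinite mu01 := by unfold mu01; infer_instance
  have hW' := hW
  obtain ⟨hm, hs, hnn, hint, hdeg⟩ := hW'
  have hf : StronglyMeasurable (f : ℝ → ℝ) := Lp.stronglyMeasurable f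
  have hi : ∀ᵐ x ∂mu01, Integrable (W x) mu01 := hint.prod_right_ae
  have hD : ∀ᵐ x ∂mu01, ∫⁻ y, ENNReal.ofReal (W x y) ∂mu01 ≤ 1 := by
    filter_upwards [hi, hdeg] with x h1 h2
    rw [← ofReal_integral_eq_lintegral_ofReal h1 (Filter.Eventually.of_forall (hnn x))]
    simpa using h2
  have hpt : ∀ᵐ x ∂mu01, ‖(f + L f : Lp ℝ p mu01) x‖ₑ ≤ ∫⁻ y, ‖f y‖ₑ ∂(gdNu W x) := by
    filter_upwards [hi, hdeg, hL f, Lp.coeFn_add f (L f)] with x h1 h2 h3 h4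
    rw [gdNu_lintegral W hm x _ hf.enorm, h4, Pi.add_apply, h3]
    exact gd_pointwise W hW f hf x h1 h2
  rw [Lp.norm_def, Lp.norm_def]
  refine ENNReal.toReal_mono (Lp.eLpNorm_ne_top f) ?_
  by_cases hpt' : p = ⊤
  · subst hpt'
    rw [eLpNorm_exponent_top, eLpNorm_exponent_top]
    refine eLpNormEssSup_le_of_ae_enorm_bound ?_
    have hb : ∀ᵐ x ∂mu01, ‖f x‖ₑ ≤ eLpNormEssSup f mu01 := enorm_ae_le_eLpNormEssSup _ _
    filter_upwards [hpt, hb, hD] with x h1 h2 h3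
    refine h1.trans ?_
    rw [gdNu_lintegral W hm x _ hf.enorm]
    set M := eLpNormEssSup f mu01
    calc _ ≤ (∫⁻ y, ENNReal.ofReal (W x y) * M ∂mu01) +
          (1 - ∫⁻ y, ENNReal.ofReal (W x y) ∂mu01) * M := by
            refine add_le_add (lintegral_mono_ae ?_) (by gcongr)
            filter_upwards [hb] with y hy
            gcongr
      _ = M := by
          rw [lintegral_mul_const _ (hm.of_uncurry_left (x := x)).ennreal_ofReal, ← add_mul,
            add_tsub_cancel_of_le h3, one_mul]
  · have hp0 : p ≠ 0 := (zero_lt_one.trans_le hp.out).ne'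
    have hq : 0 < p.toReal := ENNReal.toReal_pos hp0 hpt'
    rw [eLpNorm_eq_lintegral_rpow_enorm_toReal hp0 hpt',
      eLpNorm_eq_lintegral_rpow_enorm_toReal hp0 hpt']
    refine ENNReal.rpow_le_rpow ?_ (by positivity)
    set F : ℝ → ℝ≥0∞ := fun y => ‖f y‖ₑ ^ p.toReal with hFdef
    have hF : Measurable F := hf.enorm.pow_const _
    have hwm : Measurable (Function.uncurry fun x y => ENNReal.ofReal (W x y)) := hm.ennreal_ofReal
    have hDm : Measurable (fun x => ∫⁻ y, ENNReal.ofReal (W x y) ∂mu01) := hwm.lintegral_prod_right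
    calc _ ≤ ∫⁻ x, ((∫⁻ y, ENNReal.ofReal (W x y) * F y ∂mu01) +
      (1 - ∫⁻ y, ENNReal.ofReal (W x y) ∂mu01) * F x) ∂mu01 := by
          refine lintegral_mono_ae ?_
          filter_upwards [hpt, hD] with x h1 h2
          haveI := gdNu_prob W x h2
          rw [← gdNu_lintegral W hm x F hF]
          have := eLpNorm_le_eLpNorm_of_exponent_le (μ := gdNu W x) hp.out hf.aestronglyMeasurable
          rw [eLpNorm_one_eq_lintegral_enorm, eLpNorm_eq_lintegral_rpow_enorm_toReal hp0 hpt'] at this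
          have h5 := ENNReal.rpow_le_rpow (h1.trans this) hq.le
          rwa [← ENNReal.rpow_mul, one_div, inv_mul_cancel₀ hq.ne', ENNReal.rpow_one] at h5
      _ = (∫⁻ x, (∫⁻ y, ENNReal.ofReal (W x y) * F y ∂mu01) ∂mu01) +
          ∫⁻ x, (1 - ∫⁻ y, ENNReal.ofReal (W x y) ∂mu01) * F x ∂mu01 :=
          lintegral_add_right _ ((measurable_const.sub hDm).mul hF)
      _ = (∫⁻ x, (∫⁻ y, ENNReal.ofReal (W x y) ∂mu01) * F x ∂mu01) +
          ∫⁻ x, (1 - ∫⁻ y, ENNReal.ofReal (W x y) ∂mu01) * F x ∂mu01 := by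
          congr 1
          rw [lintegral_lintegral_swap (hwm.mul (hF.comp measurable_snd)).aemeasurable]
          refine lintegral_congr fun y => ?_
          rw [lintegral_mul_const _ (hm.of_uncurry_right (y := y)).ennreal_ofReal]
          simp_rw [hs _ y]
      _ = ∫⁻ x, F x ∂mu01 := by
          have hmm : Measurable (fun x => (∫⁻ y, ENNReal.ofReal (W x y) ∂mu01) * F x) := hDm.mul hF
          rw [← lintegral_add_left hmm]
          refine lintegral_congr_ae ?_
          filter_upwards [hD] with x hx
          rw [← add_mul, add_tsub_cancel_of_le hx, one_mul]

lemma gd_abstract {E : Type*} [NormedAddCommGroup E] [NormedSpace ℝ E] (L : E →L[ℝ] E)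
    (hc : ∀ f, ‖f + L f‖ ≤ ‖f‖) (T : ℝ) (u : ℝ → E)
    (hsol : ∀ t ∈ Icc (0:ℝ) T, HasDerivWithinAt u (L (u t)) (Icc 0 T) t) :
    ∀ t ∈ Icc (0:ℝ) T, ‖u t‖ ≤ ‖u 0‖ := by
  have hcont : ContinuousOn (fun t => ‖u t‖) (Icc 0 T) :=
    ContinuousOn.norm fun t ht => (hsol t ht).continuousWithinAt
  intro t ht
  refine image_le_of_liminf_slope_right_le_deriv_boundary (f := fun t => ‖u t‖)
    (B := fun _ => ‖u 0‖) (B' := fun _ => 0) hcont le_rfl continuousOn_const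
    (fun x _ => hasDerivWithinAt_const _ _ _) ?_ ht
  intro x hx r hr
  apply Filter.Eventually.frequently
  have h1 : HasDerivWithinAt u (L (u x)) (Ioi x) x :=
    (hsol x ⟨hx.1, hx.2.le⟩).mono_of_mem_nhdsWithin
      (Filter.mem_of_superset (Ioo_mem_nhdsGT hx.2) fun z hz => ⟨hx.1.trans hz.1.le, hz.2.le⟩)
  have h2 := (hasDerivWithinAt_iff_isLittleO.1 h1).def (half_pos hr)
  filter_upwards [h2, Ioo_mem_nhdsGT (show x < x + 1 by linarith)] with z hz hz1
  have hpos : 0 < z - x := sub_pos.2 hz1.1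
  have hle : z - x ≤ 1 := by linarith [hz1.2]
  rw [Real.norm_of_nonneg hpos.le] at hz
  have h3 : ‖u x + (z - x) • L (u x)‖ ≤ ‖u x‖ := by
    have : u x + (z - x) • L (u x) = (1 - (z - x)) • u x + (z - x) • (u x + L (u x)) := by
      module
    rw [this]
    refine (norm_add_le _ _).trans ?_
    rw [norm_smul, norm_smul, Real.norm_of_nonneg hpos.le, Real.norm_of_nonneg (by linarith)]
    nlinarith [hc (u x)]
  have h4 : ‖u z‖ ≤ ‖u x + (z - x) • L (u x)‖ + ‖u z - u x - (z - x) • L (u x)‖ := by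
    refine le_trans (le_of_eq ?_) (norm_add_le _ _)
    congr 1
    abel
  rw [slope_def_field, div_lt_iff₀ hpos]
  nlinarith [mul_pos hr hpos]

/-- maximum bound principle / stability: a classical solution
u ∈ C¹([0,T]; L^p((0,1))) of the graphon diffusion equation satisfies
sup_{t ∈ [0,T]} ‖u(t)‖_p ≤ ‖u₀‖_p, for p ∈ [1,∞]. -/
theorem graphonDiffusion_stability (p : ℝ≥0∞) [Fact (1 ≤ p)]
    (T : ℝ) (hT : 0 < T)
    (W : ℝ → ℝ → ℝ) (hW : IsGraphon W)
    (L : Lp ℝ p mu01 →L[ℝ] Lp ℝ p mu01)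
    (hL : ∀ f : Lp ℝ p mu01, (L f : ℝ → ℝ) =ᵐ[mu01] graphonLap W f)
    (u : ℝ → Lp ℝ p mu01) (u₀ : Lp ℝ p mu01) (hu0 : u 0 = u₀)
    (hsol : ∀ t ∈ Icc (0:ℝ) T, HasDerivWithinAt u (L (u t)) (Icc 0 T) t) :
    ∀ t ∈ Icc (0:ℝ) T, ‖u t‖ ≤ ‖u₀‖ := by
  subst hu0
  exact gd_abstract L (gd_contract p W hW L hL) T u hsol
end

section
/- Let p ∈ [1,∞) and T > 0. Let W_n and W be graphons (measurable, symmetric, nonnegative, in L¹((0,1)²), with degrees bounded by 1 a.e.). Let u_n ∈ C¹([0,T]; L^p((0,1))) be a classical solution of the graph diffusion equation ∂u_n/∂t = ℒ^{W_n} u_n with u_n(·,0) ∈ L^p((0,1)), and let u ∈ C¹([0,T]; L^∞((0,1))) be a classical solution of the graphon diffusion equation ∂u/∂t = ℒ^W u with u(·,0) ∈ L^∞((0,1)). Then for all t ∈ [0,T], ‖u(·,t) − u_n(·,t)‖_{L^p} ≤ ‖u(·,0) − u_n(·,0)‖_{L^p} + 4 t ‖u(·,0)‖_{L^∞} ‖W_n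 − W‖_□^{1/p}. -/
open MeasureTheory Set ENNReal

/-- The cut norm of a kernel V on (0,1)²:
sup over measurable φ, ψ : (0,1) → [-1,1] of ∫∫ V(x,y) φ(x) ψ(y) dx dy. -/
noncomputable def cutNorm (V : ℝ → ℝ → ℝ) : ℝ :=
  sSup {r : ℝ | ∃ φ ψ : ℝ → ℝ, Measurable φ ∧ Measurable ψ ∧
    (∀ x, φ x ∈ Icc (-1:ℝ) 1) ∧ (∀ x, ψ x ∈ Icc (-1:ℝ) 1) ∧
    r = ∫ x, ∫ y, V x y * φ x * ψ y ∂mu01 ∂mu01}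

instance instProbMu01 : IsProbabilityMeasure mu01 := ⟨by simp [mu01]⟩

lemma abstract_contr {E : Type*} [NormedAddCommGroup E] [NormedSpace ℝ E] (A : E → E)
    (hA : ∀ f, ‖f + A f‖ ≤ ‖f‖) (T C : ℝ) (w g : ℝ → E)
    (hw : ∀ t ∈ Icc (0:ℝ) T, HasDerivWithinAt w (A (w t) + g t) (Icc 0 T) t)
    (hg : ∀ t ∈ Icc (0:ℝ) T, ‖g t‖ ≤ C) :
    ∀ t ∈ Icc (0:ℝ) T, ‖w t‖ ≤ ‖w 0‖ + C * t := by
  have key : ∀ ε > 0, ∀ t ∈ Icc (0:ℝ) T, ‖w t‖ ≤ ‖w 0‖ + (C + ε) * t := by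
    intro ε hε t ht
    have h1 : ∀ t ∈ Icc (0:ℝ) T, HasDerivWithinAt (fun t => Real.exp t • w t)
        (Real.exp t • (A (w t) + g t) + Real.exp t • w t) (Icc 0 T) t := fun t ht =>
      (Real.hasDerivAt_exp t).hasDerivWithinAt.smul (hw t ht)
    have h2 := image_norm_le_of_norm_deriv_right_lt_deriv_boundary
      (f := fun t => Real.exp t • w t) (a := 0) (b := T)
      (f' := fun t => Real.exp t • (A (w t) + g t) + Real.exp t • w t)
      (B := fun t => Real.exp t * (‖w 0‖ + (C + ε) * t))
      (B' := fun t => Real.exp t * (‖w 0‖ + (C + ε) * t) + Real.exp t * (C + ε))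
      (fun t ht => (h1 t ht).continuousWithinAt)
      (fun t ht => ((h1 t (Ico_subset_Icc_self ht)).mono_of_mem_nhdsWithin
        (Icc_mem_nhdsGE_of_mem ht)))
      (by simp)
      (fun x => by
        have := (Real.hasDerivAt_exp x).mul
          (((hasDerivAt_id x).const_mul (C + ε)).const_add ‖w 0‖)
        simp only [id, mul_one] at this
        exact this)
      (by
        intro x hx hxe
        have hx' := Ico_subset_Icc_self hx
        have e1 : Real.exp x • (A (w x) + g x) + Real.exp x • w x
          = Real.exp x • (w x + A (w x)) + Real.exp x • g x := by
          simp only [smul_add]; abel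
        simp only [norm_smul, Real.norm_eq_abs, Real.abs_exp] at hxe
        rw [e1, ← hxe]
        refine (norm_add_le _ _).trans_lt ?_
        simp only [norm_smul, Real.norm_eq_abs, Real.abs_exp]
        have := hA (w x)
        have := hg x hx'
        have := Real.exp_pos x
        nlinarith [mul_le_mul_of_nonneg_left (hA (w x)) this.le,
          mul_le_mul_of_nonneg_left (hg x hx') this.le, mul_pos this hε]) ht
    simp only [norm_smul, Real.norm_eq_abs, Real.abs_exp] at h2
    exact le_of_mul_le_mul_left h2 (Real.exp_pos t)
  intro t ht
  refine le_of_forall_pos_le_add fun ε hε => ?_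
  have := key (ε / (t + 1)) (by have := ht.1; positivity) t ht
  have h0 := ht.1
  have h3 : ε / (t+1) * t ≤ ε := by
    rw [div_mul_eq_mul_div, div_le_iff₀ (by positivity)]; nlinarith
  nlinarith

lemma pointwise_bound {W : ℝ → ℝ → ℝ} (hW : IsGraphon W) (f : ℝ → ℝ) (hf : Measurable f) :
    ∀ᵐ x ∂mu01, (∫⁻ y, ENNReal.ofReal (W x y) ∂mu01) ≤ 1 ∧
      ‖f x + graphonLap W f x‖ₑ ≤
        (1 - ∫⁻ y, ENNReal.ofReal (W x y) ∂mu01) * ‖f x‖ₑ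
          + ∫⁻ y, ENNReal.ofReal (W x y) * ‖f y‖ₑ ∂mu01 := by
  obtain ⟨hm, hs, h0, hi, hd⟩ := hW
  filter_upwards [hd, hi.prod_right_ae] with x hx hix
  simp only [Function.uncurry_apply_pair] at hix
  have e1 : (∫⁻ y, ENNReal.ofReal (W x y) ∂mu01) = ENNReal.ofReal (∫ y, W x y ∂mu01) :=
    (ofReal_integral_eq_lintegral_ofReal hix (Filter.Eventually.of_forall (h0 x))).symm
  have hmx : Measurable (W x) := hm.comp measurable_prodMk_left
  have e2 : (∫⁻ y, ENNReal.ofReal (W x y) * ‖f y‖ₑ ∂mu01) = ∫⁻ y, ‖W x y * f y‖ₑ ∂mu01 := by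
    refine lintegral_congr fun y => ?_
    rw [enorm_mul, Real.enorm_of_nonneg (h0 x y)]
  refine ⟨by rw [e1]; simpa using hx, ?_⟩
  rw [e2]
  by_cases hfin : Integrable (fun y => W x y * f y) mu01
  · have e3 : f x + graphonLap W f x
        = (1 - ∫ y, W x y ∂mu01) * f x + ∫ y, W x y * f y ∂mu01 := by
      simp only [graphonLap, mul_sub]
      rw [integral_sub hfin (hix.mul_const _), integral_mul_const]; ring
    rw [e3]
    refine (enorm_add_le _ _).trans (add_le_add ?_ (enorm_integral_le_lintegral_enorm _))
    rw [enorm_mul, Real.enorm_of_nonneg (by linarith), ENNReal.ofReal_sub _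
      (integral_nonneg (h0 x)), e1]
    simp
  · have : (∫⁻ y, ‖W x y * f y‖ₑ ∂mu01) = ⊤ := by
      by_contra h
      exact hfin ⟨(hmx.mul hf).aestronglyMeasurable, lt_top_iff_ne_top.2 h⟩
    rw [this]; simp

lemma jensen {W : ℝ → ℝ → ℝ} (hW : IsGraphon W) (p : ℝ) (hp : 1 ≤ p)
    (f : ℝ → ℝ) (hf : Measurable f) (x : ℝ)
    (hx : (∫⁻ y, ENNReal.ofReal (W x y) ∂mu01) ≤ 1) :
    ((1 - ∫⁻ y, ENNReal.ofReal (W x y) ∂mu01) * ‖f x‖ₑ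
          + ∫⁻ y, ENNReal.ofReal (W x y) * ‖f y‖ₑ ∂mu01) ^ p ≤
    (1 - ∫⁻ y, ENNReal.ofReal (W x y) ∂mu01) * ‖f x‖ₑ ^ p
          + ∫⁻ y, ENNReal.ofReal (W x y) * ‖f y‖ₑ ^ p ∂mu01 := by
  have hmx : Measurable fun y => ENNReal.ofReal (W x y) :=
    (hW.1.comp measurable_prodMk_left).ennreal_ofReal
  set d := ∫⁻ y, ENNReal.ofReal (W x y) ∂mu01 with hd
  let ν : Measure ℝ := (1 - d) • Measure.dirac x +
    mu01.withDensity (fun y => ENNReal.ofReal (W x y))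
  have hν : IsProbabilityMeasure ν := ⟨by
    simp [ν, ← hd, tsub_add_cancel_of_le hx]⟩
  have hint : ∀ g : ℝ → ℝ≥0∞, Measurable g → ∫⁻ y, g y ∂ν =
      (1 - d) * g x + ∫⁻ y, ENNReal.ofReal (W x y) * g y ∂mu01 := by
    intro g hg
    simp only [ν]
    rw [lintegral_add_measure, lintegral_smul_measure, lintegral_dirac' _ hg,
      lintegral_withDensity_eq_lintegral_mul _ hmx hg]
    simp
  have h1 := eLpNorm_le_eLpNorm_of_exponent_le (μ := ν) (f := f) (p := 1) (q := ENNReal.ofReal p)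
    (by simpa using hp) hf.aestronglyMeasurable
  rw [eLpNorm_one_eq_lintegral_enorm, eLpNorm_eq_lintegral_rpow_enorm_toReal
    (by simp; linarith) (by simp), ENNReal.toReal_ofReal (by linarith), one_div,
    ENNReal.le_rpow_inv_iff (by linarith)] at h1
  rwa [hint _ hf.enorm, hint _ (hf.enorm.pow_const p)] at h1

lemma contr_p {W : ℝ → ℝ → ℝ} (hW : IsGraphon W) (p : ℝ) (hp : 1 ≤ p)
    (f : ℝ → ℝ) (hf : Measurable f) :
    eLpNorm (fun x => f x + graphonLap W f x) (ENNReal.ofReal p) mu01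
      ≤ eLpNorm f (ENNReal.ofReal p) mu01 := by
  have hp0 : ENNReal.ofReal p ≠ 0 := by simp; linarith
  rw [eLpNorm_eq_lintegral_rpow_enorm_toReal hp0 (by simp),
    eLpNorm_eq_lintegral_rpow_enorm_toReal hp0 (by simp), ENNReal.toReal_ofReal (by linarith)]
  refine ENNReal.rpow_le_rpow ?_ (by positivity)
  have hm2 : Measurable fun z : ℝ × ℝ => ENNReal.ofReal (W z.1 z.2) := hW.1.ennreal_ofReal
  have hmd : Measurable fun x => ∫⁻ y, ENNReal.ofReal (W x y) ∂mu01 :=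
    hm2.lintegral_prod_right'
  have hfp : Measurable fun x => ‖f x‖ₑ ^ p := hf.enorm.pow_const p
  calc ∫⁻ x, ‖f x + graphonLap W f x‖ₑ ^ p ∂mu01
      ≤ ∫⁻ x, ((1 - ∫⁻ y, ENNReal.ofReal (W x y) ∂mu01) * ‖f x‖ₑ ^ p
          + ∫⁻ y, ENNReal.ofReal (W x y) * ‖f y‖ₑ ^ p ∂mu01) ∂mu01 := by
        refine lintegral_mono_ae ?_
        filter_upwards [pointwise_bound hW f hf] with x hx
        exact (ENNReal.rpow_le_rpow hx.2 (by linarith)).trans (jensen hW p hp f hf x hx.1)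
    _ = ∫⁻ x, (1 - ∫⁻ y, ENNReal.ofReal (W x y) ∂mu01) * ‖f x‖ₑ ^ p ∂mu01
          + ∫⁻ x, ∫⁻ y, ENNReal.ofReal (W x y) * ‖f y‖ₑ ^ p ∂mu01 ∂mu01 :=
        lintegral_add_left ((measurable_const.sub hmd).mul hfp) _
    _ = ∫⁻ x, (1 - ∫⁻ y, ENNReal.ofReal (W x y) ∂mu01) * ‖f x‖ₑ ^ p ∂mu01
          + ∫⁻ x, (∫⁻ y, ENNReal.ofReal (W x y) ∂mu01) * ‖f x‖ₑ ^ p ∂mu01 := by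
        congr 1
        rw [lintegral_lintegral_swap]
        · refine lintegral_congr fun y => ?_
          have hmy : Measurable fun x => ENNReal.ofReal (W x y) := hm2.comp measurable_prodMk_right
          rw [lintegral_mul_const _ hmy]
          simp_rw [hW.2.1 _ y]
        · exact (hm2.mul (hfp.comp measurable_snd)).aemeasurable
    _ = ∫⁻ x, ‖f x‖ₑ ^ p ∂mu01 := by
        have hms : Measurable fun x =>
            (1 - ∫⁻ y, ENNReal.ofReal (W x y) ∂mu01) * ‖f x‖ₑ ^ p :=
          (measurable_const.sub hmd).mul hfp
        rw [← lintegral_add_left hms]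
        refine lintegral_congr_ae ?_
        filter_upwards [pointwise_bound hW f hf] with x hx
        rw [← add_mul, tsub_add_cancel_of_le hx.1, one_mul]

lemma contr_top {W : ℝ → ℝ → ℝ} (hW : IsGraphon W)
    (f : ℝ → ℝ) (hf : Measurable f) :
    eLpNorm (fun x => f x + graphonLap W f x) ⊤ mu01 ≤ eLpNorm f ⊤ mu01 := by
  simp only [eLpNorm_exponent_top]
  refine essSup_le_of_ae_le _ ?_
  filter_upwards [pointwise_bound hW f hf, ae_le_eLpNormEssSup (f := f) (μ := mu01)] with x hx hfx
  refine hx.2.trans ?_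
  set M := eLpNormEssSup f mu01
  have hmx : Measurable fun y => ENNReal.ofReal (W x y) :=
    (hW.1.comp measurable_prodMk_left).ennreal_ofReal
  calc _ ≤ (1 - ∫⁻ y, ENNReal.ofReal (W x y) ∂mu01) * M
          + ∫⁻ y, ENNReal.ofReal (W x y) * M ∂mu01 := by
        gcongr ?_ + ?_
        · gcongr
        · refine lintegral_mono_ae ?_
          filter_upwards [ae_le_eLpNormEssSup (f := f) (μ := mu01)] with y hy
          gcongr
    _ = M := by
        rw [lintegral_mul_const _ hmx, ← add_mul, tsub_add_cancel_of_le hx.1, one_mul]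

lemma contr_Lp {W : ℝ → ℝ → ℝ} (q : ℝ≥0∞) [Fact (1 ≤ q)] (A : Lp ℝ q mu01 →L[ℝ] Lp ℝ q mu01)
    (hA : ∀ f : Lp ℝ q mu01, (A f : ℝ → ℝ) =ᵐ[mu01] graphonLap W f)
    (h : ∀ f : ℝ → ℝ, Measurable f →
      eLpNorm (fun x => f x + graphonLap W f x) q mu01 ≤ eLpNorm f q mu01)
    (f : Lp ℝ q mu01) : ‖f + A f‖ ≤ ‖f‖ := by
  rw [Lp.norm_def, Lp.norm_def]
  refine ENNReal.toReal_mono (Lp.eLpNorm_ne_top f) ?_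
  refine le_trans (le_of_eq (eLpNorm_congr_ae ?_)) (h f (Lp.stronglyMeasurable f).measurable)
  filter_upwards [Lp.coeFn_add f (A f), hA f] with x h1 h2
  rw [h1, Pi.add_apply, h2]

lemma cut_integrable {V : ℝ → ℝ → ℝ}
    (hi : Integrable (Function.uncurry V) (mu01.prod mu01)) (φ : ℝ × ℝ → ℝ)
    (hφ : Measurable φ) (C : ℝ) (h1 : ∀ z, ‖φ z‖ ≤ C) :
    Integrable (fun z : ℝ × ℝ => V z.1 z.2 * φ z) (mu01.prod mu01) :=
  Integrable.mul_bdd (c := C) hi hφ.aestronglyMeasurable (Filter.Eventually.of_forall h1)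

lemma cut_le {V : ℝ → ℝ → ℝ}
    (hi : Integrable (Function.uncurry V) (mu01.prod mu01)) (φ ψ : ℝ → ℝ)
    (hφ : Measurable φ) (hψ : Measurable ψ) (h1 : ∀ x, φ x ∈ Icc (-1:ℝ) 1)
    (h2 : ∀ x, ψ x ∈ Icc (-1:ℝ) 1) :
    ∫ z, V z.1 z.2 * (φ z.1 * ψ z.2) ∂(mu01.prod mu01) ≤ cutNorm V := by
  have hb : ∀ (φ ψ : ℝ → ℝ), (∀ x, φ x ∈ Icc (-1:ℝ) 1) → (∀ x, ψ x ∈ Icc (-1:ℝ) 1) →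
      ∀ z : ℝ × ℝ, ‖φ z.1 * ψ z.2‖ ≤ 1 := by
    intro φ ψ h1 h2 z
    rw [norm_mul]
    exact mul_le_one₀ (abs_le.2 (h1 _)) (norm_nonneg _) (abs_le.2 (h2 _))
  have heq : ∀ (φ ψ : ℝ → ℝ), Measurable φ → Measurable ψ → (∀ x, φ x ∈ Icc (-1:ℝ) 1) →
      (∀ x, ψ x ∈ Icc (-1:ℝ) 1) → ∫ x, ∫ y, V x y * φ x * ψ y ∂mu01 ∂mu01 =
      ∫ z, V z.1 z.2 * (φ z.1 * ψ z.2) ∂(mu01.prod mu01) := by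
    intro φ ψ hφ hψ h1 h2
    rw [integral_prod _ (cut_integrable hi (fun z => φ z.1 * ψ z.2)
      ((hφ.comp measurable_fst).mul (hψ.comp measurable_snd)) 1 (hb φ ψ h1 h2))]
    simp only [mul_assoc]
  refine le_csSup ⟨∫ z, ‖Function.uncurry V z‖ ∂(mu01.prod mu01), ?_⟩
    ⟨φ, ψ, hφ, hψ, h1, h2, (heq φ ψ hφ hψ h1 h2).symm⟩
  rintro r ⟨φ, ψ, hφ, hψ, h1, h2, rfl⟩
  rw [heq φ ψ hφ hψ h1 h2]
  refine (Real.le_norm_self _).trans ((norm_integral_le_integral_norm _).trans ?_)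
  refine integral_mono (cut_integrable hi (fun z => φ z.1 * ψ z.2)
      ((hφ.comp measurable_fst).mul (hψ.comp measurable_snd)) 1 (hb φ ψ h1 h2)).norm hi.norm ?_
  intro z
  simp only [norm_mul (V z.1 z.2)]
  exact mul_le_of_le_one_right (norm_nonneg _) (hb φ ψ h1 h2 z)

lemma cut_nonneg {V : ℝ → ℝ → ℝ}
    (hi : Integrable (Function.uncurry V) (mu01.prod mu01)) : 0 ≤ cutNorm V := by
  simpa using cut_le hi (fun _ => 0) (fun _ => 0) measurable_const measurable_const
    (by simp) (by simp)

lemma source_L1 {V : ℝ → ℝ → ℝ} (hm : Measurable (Function.uncurry V))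
    (hi : Integrable (Function.uncurry V) (mu01.prod mu01)) (ψ : ℝ → ℝ) (hψ : Measurable ψ)
    (h2 : ∀ x, ψ x ∈ Icc (-1:ℝ) 1) :
    ∫⁻ x, ‖graphonLap V ψ x‖ₑ ∂mu01 ≤ ENNReal.ofReal (2 * cutNorm V) := by
  have hψ2 : ∀ x, |ψ x| ≤ 1 := fun x => abs_le.2 (h2 x)
  have hgi0 : Integrable (fun z : ℝ × ℝ => V z.1 z.2 * (ψ z.2 - ψ z.1)) (mu01.prod mu01) :=
    cut_integrable hi (fun z => ψ z.2 - ψ z.1)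
      ((hψ.comp measurable_snd).sub (hψ.comp measurable_fst)) 2 (fun z => by
        have a := hψ2 z.2
        have b := hψ2 z.1
        have c := abs_sub (ψ z.2) (ψ z.1)
        rw [Real.norm_eq_abs]
        linarith)
  have hgi : Integrable (graphonLap V ψ) mu01 := hgi0.integral_prod_left
  have hgm : Measurable (graphonLap V ψ) := by
    have : Measurable (fun z : ℝ × ℝ => V z.1 z.2 * (ψ z.2 - ψ z.1)) :=
      hm.mul ((hψ.comp measurable_snd).sub (hψ.comp measurable_fst))
    exact (this.stronglyMeasurable.integral_prod_right').measurable
  rw [← ofReal_integral_norm_eq_lintegral_enorm hgi]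
  refine ENNReal.ofReal_le_ofReal ?_
  let φ : ℝ → ℝ := fun x => if 0 ≤ graphonLap V ψ x then 1 else -1
  have hφm : Measurable φ := Measurable.ite (measurableSet_le measurable_const hgm)
    measurable_const measurable_const
  have hφ1 : ∀ x, φ x ∈ Icc (-1:ℝ) 1 := by
    intro x; simp only [φ]; split_ifs <;> simp
  have hφ2 : ∀ x, |φ x| ≤ 1 := fun x => abs_le.2 (hφ1 x)
  have hi1 : Integrable (fun z : ℝ × ℝ => V z.1 z.2 * (φ z.1 * ψ z.2)) (mu01.prod mu01) :=
    cut_integrable hi (fun z => φ z.1 * ψ z.2)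
      ((hφm.comp measurable_fst).mul (hψ.comp measurable_snd)) 1 (fun z => by
        rw [norm_mul]; exact mul_le_one₀ (hφ2 _) (norm_nonneg _) (hψ2 _))
  have hi2 : Integrable (fun z : ℝ × ℝ => V z.1 z.2 * ((-φ z.1 * ψ z.1) * 1)) (mu01.prod mu01) :=
    cut_integrable hi (fun z => (-φ z.1 * ψ z.1) * 1)
      (((hφm.comp measurable_fst).neg.mul (hψ.comp measurable_fst)).mul measurable_const) 1
      (fun z => by
        rw [mul_one, norm_mul, norm_neg]; exact mul_le_one₀ (hφ2 _) (norm_nonneg _) (hψ2 _))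
  have e : ∫ x, ‖graphonLap V ψ x‖ ∂mu01 =
      ∫ z, V z.1 z.2 * (φ z.1 * ψ z.2) ∂(mu01.prod mu01) +
      ∫ z, V z.1 z.2 * ((-φ z.1 * ψ z.1) * 1) ∂(mu01.prod mu01) := by
    have hi3 : Integrable (fun z : ℝ × ℝ => V z.1 z.2 * (φ z.1 * ψ z.2) +
        V z.1 z.2 * ((-φ z.1 * ψ z.1) * 1)) (mu01.prod mu01) := hi1.add hi2
    rw [← integral_add hi1 hi2, integral_prod _ hi3]
    refine integral_congr_ae (Filter.Eventually.of_forall fun x => ?_)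
    have : ‖graphonLap V ψ x‖ = φ x * graphonLap V ψ x := by
      simp only [φ, Real.norm_eq_abs]
      split_ifs with h
      · rw [abs_of_nonneg h, one_mul]
      · rw [abs_of_neg (not_le.1 h)]; ring
    simp only [this]
    rw [graphonLap, ← integral_const_mul]
    refine integral_congr_ae (Filter.Eventually.of_forall fun y => ?_)
    simp only []
    ring
  rw [e, two_mul]
  refine add_le_add (cut_le hi φ ψ hφm hψ hφ1 h2)
    (cut_le hi (fun x => -φ x * ψ x) (fun _ => 1) (hφm.neg.mul hψ) measurable_const ?_ (by simp))
  intro x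
  refine abs_le.1 ?_
  rw [abs_mul, abs_neg]
  exact mul_le_one₀ (hφ2 _) (abs_nonneg _) (hψ2 _)

lemma source_top {Wn W : ℝ → ℝ → ℝ} (hWn : IsGraphon Wn) (hW : IsGraphon W)
    (ψ : ℝ → ℝ) (h2 : ∀ x, ψ x ∈ Icc (-1:ℝ) 1) :
    ∀ᵐ x ∂mu01, ‖graphonLap (fun x y => Wn x y - W x y) ψ x‖ₑ ≤ 4 := by
  have hψ2 : ∀ x, |ψ x| ≤ 1 := fun x => abs_le.2 (h2 x)
  filter_upwards [hWn.2.2.2.2, hW.2.2.2.2, hWn.2.2.2.1.prod_right_ae, hW.2.2.2.1.prod_right_ae]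
    with x a b c d
  simp only [Function.uncurry_apply_pair] at c d
  have : ‖graphonLap (fun x y => Wn x y - W x y) ψ x‖ ≤ 4 := by
    calc _ ≤ ∫ y, (Wn x y + W x y) * 2 ∂mu01 := by
          refine norm_integral_le_of_norm_le ((c.add d).mul_const 2)
            (Filter.Eventually.of_forall fun y => ?_)
          rw [norm_mul, Real.norm_eq_abs, Real.norm_eq_abs]
          refine mul_le_mul ?_ ?_ (abs_nonneg _) (add_nonneg (hWn.2.2.1 x y) (hW.2.2.1 x y))
          · have := hWn.2.2.1 x y
            have := hW.2.2.1 x y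
            rw [abs_le]; constructor <;> linarith
          · have := abs_sub (ψ y) (ψ x)
            have := hψ2 x
            have := hψ2 y
            linarith
      _ ≤ 4 := by
          rw [integral_mul_const, integral_add c d]; linarith
  rw [← ofReal_norm]
  refine (ENNReal.ofReal_le_ofReal this).trans (by simp)

lemma source_p {Wn W : ℝ → ℝ → ℝ} (hWn : IsGraphon Wn) (hW : IsGraphon W) (p : ℝ) (hp : 1 ≤ p)
    (ψ : ℝ → ℝ) (hψ : Measurable ψ) (h2 : ∀ x, ψ x ∈ Icc (-1:ℝ) 1) :
    eLpNorm (graphonLap (fun x y => Wn x y - W x y) ψ) (ENNReal.ofReal p) mu01 ≤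
      ENNReal.ofReal (4 * cutNorm (fun x y => Wn x y - W x y) ^ (1 / p)) := by
  have hi : Integrable (Function.uncurry fun x y => Wn x y - W x y) (mu01.prod mu01) :=
    hWn.2.2.2.1.sub hW.2.2.2.1
  have hm : Measurable (Function.uncurry fun x y => Wn x y - W x y) := hWn.1.sub hW.1
  have h1 := source_L1 hm hi ψ hψ h2
  have h3 := source_top hWn hW ψ h2
  have h0 := cut_nonneg hi
  set g := graphonLap (fun x y => Wn x y - W x y) ψ
  set c := cutNorm (fun x y => Wn x y - W x y)
  rw [eLpNorm_eq_lintegral_rpow_enorm_toReal (by simp; linarith) (by simp),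
    ENNReal.toReal_ofReal (by linarith), one_div, ENNReal.rpow_inv_le_iff (by linarith)]
  have h4 : (4:ℝ≥0∞) = ENNReal.ofReal 4 := by simp
  calc ∫⁻ x, ‖g x‖ₑ ^ p ∂mu01 ≤ ∫⁻ x, 4 ^ (p - 1) * ‖g x‖ₑ ∂mu01 := by
        refine lintegral_mono_ae ?_
        filter_upwards [h3] with x hx
        calc ‖g x‖ₑ ^ p = ‖g x‖ₑ ^ ((p - 1) + 1) := by congr 1; ring
          _ = ‖g x‖ₑ ^ (p - 1) * ‖g x‖ₑ := by
            rw [ENNReal.rpow_add_of_nonneg _ _ (by linarith) (by norm_num), ENNReal.rpow_one]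
          _ ≤ _ := by
            gcongr
    _ = 4 ^ (p - 1) * ∫⁻ x, ‖g x‖ₑ ∂mu01 := by
        refine lintegral_const_mul' _ _ (ENNReal.rpow_ne_top_of_nonneg (by linarith) (by simp))
    _ ≤ 4 ^ (p - 1) * ENNReal.ofReal (2 * c) := by gcongr
    _ ≤ ENNReal.ofReal (4 * c ^ p⁻¹) ^ p := by
        rw [h4, ENNReal.ofReal_rpow_of_nonneg (by norm_num) (by linarith),
          ENNReal.ofReal_rpow_of_nonneg (by positivity) (by linarith),
          ← ENNReal.ofReal_mul (by positivity)]
        refine ENNReal.ofReal_le_ofReal ?_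
        rw [Real.mul_rpow (by norm_num) (by positivity), Real.rpow_inv_rpow h0 (by linarith),
          Real.rpow_sub (by norm_num), Real.rpow_one]
        have : (0:ℝ) ≤ 4 ^ p := by positivity
        nlinarith [mul_nonneg this h0]

lemma ae_bound_top (f : Lp ℝ ⊤ mu01) : ∀ᵐ x ∂mu01, ‖f x‖ ≤ ‖f‖ := by
  filter_upwards [ae_le_eLpNormEssSup (f := f) (μ := mu01)] with x hx
  rw [← eLpNorm_exponent_top, ← Lp.enorm_def] at hx
  rwa [enorm_le_iff_norm_le] at hx

lemma graphonLap_congr {V : ℝ → ℝ → ℝ} {f g : ℝ → ℝ} (h : f =ᵐ[mu01] g) :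
    graphonLap V f =ᵐ[mu01] graphonLap V g := by
  filter_upwards [h] with x hx
  refine integral_congr_ae ?_
  filter_upwards [h] with y hy
  rw [hx, hy]

lemma source_f {Wn W : ℝ → ℝ → ℝ} (hWn : IsGraphon Wn) (hW : IsGraphon W) (p : ℝ) (hp : 1 ≤ p)
    (f : Lp ℝ ⊤ mu01) :
    eLpNorm (fun x => graphonLap W f x - graphonLap Wn f x) (ENNReal.ofReal p) mu01 ≤
      ENNReal.ofReal (4 * ‖f‖ * cutNorm (fun x y => Wn x y - W x y) ^ (1 / p)) := by
  let ψ : ℝ → ℝ := fun x => max (-1) (min 1 (f x / ‖f‖))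
  have hfm : Measurable (f : ℝ → ℝ) := (Lp.stronglyMeasurable f).measurable
  have hψ : Measurable ψ := measurable_const.max (measurable_const.min (hfm.div_const _))
  have h2 : ∀ x, ψ x ∈ Icc (-1:ℝ) 1 := fun x => ⟨le_max_left _ _, by simp [ψ]⟩
  have hfψ : (f : ℝ → ℝ) =ᵐ[mu01] fun x => ‖f‖ * ψ x := by
    filter_upwards [ae_bound_top f] with x hx
    rcases (norm_nonneg f).eq_or_lt with h | h
    · rw [← h] at hx ⊢
      simpa using hx
    · have := abs_le.1 hx
      have a : f x / ‖f‖ ≤ 1 := by rw [div_le_one h]; exact this.2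
      have b : -1 ≤ f x / ‖f‖ := by rw [le_div_iff₀ h]; linarith [this.1]
      simp only [ψ, min_eq_right a, max_eq_right b]
      field_simp
  have key : (fun x => graphonLap W f x - graphonLap Wn f x) =ᵐ[mu01]
      (-‖f‖) • graphonLap (fun x y => Wn x y - W x y) ψ := by
    filter_upwards [graphonLap_congr (V := W) hfψ, graphonLap_congr (V := Wn) hfψ,
      hWn.2.2.2.1.prod_right_ae, hW.2.2.2.1.prod_right_ae] with x a b c d
    simp only [Function.uncurry_apply_pair] at c d
    rw [a, b]
    have hI : ∀ V : ℝ → ℝ → ℝ, Integrable (V x) mu01 →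
        Integrable (fun y => V x y * (‖f‖ * ψ y - ‖f‖ * ψ x)) mu01 := by
      intro V hV
      refine Integrable.mul_bdd (c := ‖f‖ * 2) hV
        ((hψ.const_mul _).sub measurable_const).aestronglyMeasurable
        (Filter.Eventually.of_forall fun y => ?_)
      rw [← mul_sub, norm_mul, norm_norm]
      gcongr
      have := h2 x
      have := h2 y
      rw [Real.norm_eq_abs, abs_le]
      constructor <;> linarith [(h2 x).1, (h2 x).2, (h2 y).1, (h2 y).2]
    simp only [graphonLap, Pi.smul_apply, smul_eq_mul]
    rw [← integral_sub (hI W d) (hI Wn c), ← integral_const_mul]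
    refine integral_congr_ae (Filter.Eventually.of_forall fun y => ?_)
    simp only []
    ring
  rw [eLpNorm_congr_ae key, eLpNorm_const_smul]
  have := source_p hWn hW p hp ψ hψ h2
  rw [enorm_neg, mul_comm 4, mul_assoc, ENNReal.ofReal_mul (norm_nonneg _), enorm_norm,
    ofReal_norm]
  gcongr

lemma memLp_of_top {q : ℝ≥0∞} (f : Lp ℝ ⊤ mu01) : MemLp f q mu01 :=
  (Lp.memLp f).mono_exponent le_top

/-- embedding of L^∞ into L^q -/
noncomputable def iota (q : ℝ≥0∞) [Fact (1 ≤ q)] : Lp ℝ ⊤ mu01 →L[ℝ] Lp ℝ q mu01 :=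
  LinearMap.mkContinuous
    { toFun := fun f => (memLp_of_top f).toLp f
      map_add' := fun f g => by
        rw [← MemLp.toLp_add]
        exact (MemLp.toLp_eq_toLp_iff _ _).2 (Lp.coeFn_add f g)
      map_smul' := fun c f => by
        rw [RingHom.id_apply, ← MemLp.toLp_const_smul]
        exact (MemLp.toLp_eq_toLp_iff _ _).2 (Lp.coeFn_smul c f) } 1 (by
    intro f
    simp only [LinearMap.coe_mk, AddHom.coe_mk, one_mul]
    rw [Lp.norm_toLp, Lp.norm_def]
    exact ENNReal.toReal_mono (Lp.eLpNorm_ne_top f) (eLpNorm_le_eLpNorm_of_exponent_le le_top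
      (Lp.aestronglyMeasurable f)))

lemma coeFn_iota (q : ℝ≥0∞) [Fact (1 ≤ q)] (f : Lp ℝ ⊤ mu01) :
    (iota q f : ℝ → ℝ) =ᵐ[mu01] f := MemLp.coeFn_toLp (memLp_of_top f)

/-- convergence of solutions of graph diffusion equations to the solution
of the graphon diffusion equation, with rate controlled by the cut norm:
‖u(t) - uₙ(t)‖_p ≤ ‖u(0) - uₙ(0)‖_p + 4 t ‖u(0)‖_∞ ‖Wₙ - W‖_□^{1/p}. -/
theorem graphDiffusion_convergence (p : ℝ) (hp : 1 ≤ p) [Fact (1 ≤ ENNReal.ofReal p)]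
    (T : ℝ) (hT : 0 < T)
    (Wn W : ℝ → ℝ → ℝ) (hWn : IsGraphon Wn) (hW : IsGraphon W)
    (Ln : Lp ℝ (ENNReal.ofReal p) mu01 →L[ℝ] Lp ℝ (ENNReal.ofReal p) mu01)
    (hLn : ∀ f : Lp ℝ (ENNReal.ofReal p) mu01, (Ln f : ℝ → ℝ) =ᵐ[mu01] graphonLap Wn f)
    (L : Lp ℝ ⊤ mu01 →L[ℝ] Lp ℝ ⊤ mu01)
    (hL : ∀ f : Lp ℝ ⊤ mu01, (L f : ℝ → ℝ) =ᵐ[mu01] graphonLap W f)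
    (un : ℝ → Lp ℝ (ENNReal.ofReal p) mu01) (u : ℝ → Lp ℝ ⊤ mu01)
    (hunsol : ∀ t ∈ Icc (0:ℝ) T, HasDerivWithinAt un (Ln (un t)) (Icc 0 T) t)
    (husol : ∀ t ∈ Icc (0:ℝ) T, HasDerivWithinAt u (L (u t)) (Icc 0 T) t) :
    ∀ t ∈ Icc (0:ℝ) T,
      eLpNorm ((u t : ℝ → ℝ) - (un t : ℝ → ℝ)) (ENNReal.ofReal p) mu01 ≤
        eLpNorm ((u 0 : ℝ → ℝ) - (un 0 : ℝ → ℝ)) (ENNReal.ofReal p) mu01 +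
          ENNReal.ofReal (4 * t * ‖u 0‖ *
            cutNorm (fun x y => Wn x y - W x y) ^ (1 / p)) := by
  have hp0 : 0 ≤ cutNorm (fun x y => Wn x y - W x y) :=
    cut_nonneg (hWn.2.2.2.1.sub hW.2.2.2.1)
  have hu : ∀ t ∈ Icc (0:ℝ) T, ‖u t‖ ≤ ‖u 0‖ := by
    intro t ht
    have := abstract_contr L (contr_Lp ⊤ L hL (fun f hf => contr_top hW f hf)) T 0 u (fun _ => 0)
      (by simpa using husol) (by simp) t ht
    simpa using this
  let q := ENNReal.ofReal p
  have hq : Fact (1 ≤ q) := inferInstanceAs (Fact (1 ≤ ENNReal.ofReal p))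
  have hw := abstract_contr Ln (contr_Lp q Ln hLn (fun f hf => contr_p hWn p hp f hf)) T
    (4 * ‖u 0‖ * cutNorm (fun x y => Wn x y - W x y) ^ (1 / p))
    (fun t => iota q (u t) - un t) (fun t => iota q (L (u t)) - Ln (iota q (u t)))
    (by
      intro t ht
      have h := ((iota q).hasFDerivAt.comp_hasDerivWithinAt t (husol t ht)).sub (hunsol t ht)
      refine HasDerivWithinAt.congr_deriv (f := fun t => iota q (u t) - un t) h ?_
      rw [map_sub]; abel)
    (by
      intro t ht
      rw [Lp.norm_def]
      refine ENNReal.toReal_le_of_le_ofReal (by positivity) ?_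
      have e : ((iota q (L (u t)) - Ln (iota q (u t)) : Lp ℝ q mu01) : ℝ → ℝ) =ᵐ[mu01]
          fun x => graphonLap W (u t) x - graphonLap Wn (u t) x := by
        filter_upwards [Lp.coeFn_sub (iota q (L (u t))) (Ln (iota q (u t))),
          coeFn_iota q (L (u t)), hL (u t), hLn (iota q (u t)),
          graphonLap_congr (V := Wn) (coeFn_iota q (u t))] with x a b c d e
        rw [a, Pi.sub_apply, b, c, d, e]
      rw [eLpNorm_congr_ae e]
      refine (source_f hWn hW p hp (u t)).trans (ENNReal.ofReal_le_ofReal ?_)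
      have := hu t ht
      gcongr)
  intro t ht
  have e : ∀ s, eLpNorm ((u s : ℝ → ℝ) - (un s : ℝ → ℝ)) q mu01
      = ENNReal.ofReal ‖iota q (u s) - un s‖ := by
    intro s
    rw [ofReal_norm, Lp.enorm_def]
    refine eLpNorm_congr_ae ?_
    filter_upwards [Lp.coeFn_sub (iota q (u s)) (un s), coeFn_iota q (u s)] with x a b
    rw [a, Pi.sub_apply, Pi.sub_apply, b]
  have ht0 := ht.1
  change eLpNorm ((u t : ℝ → ℝ) - (un t : ℝ → ℝ)) q mu01 ≤
    eLpNorm ((u 0 : ℝ → ℝ) - (un 0 : ℝ → ℝ)) q mu01 + _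
  rw [e, e, ← ENNReal.ofReal_add (norm_nonneg _) (by positivity)]
  refine ENNReal.ofReal_le_ofReal ((hw t ht).trans (le_of_eq ?_))
  ring
end

section
/- Let W be a graphon (measurable, symmetric, nonnegative, W ∈ L¹((0,1)²), with degree d_W(x) = ∫₀¹ W(x,y) dy ≤ 1 for a.e. x). Let Φ : ℝ → ℝ satisfy Φ(0) = 0, be locally Lipschitz continuous, and suppose there exist constants M₁ < M₂ with Φ(M₂) ≤ 0 ≤ Φ(M₁). Let u ∈ C¹([0,T]; L^∞((0,1))) be a classical solution of the graphon reaction–diffusion equation ∂u/∂t = ℒ^W u + Φ(u) with initial condition u₀ ∈ L^∞((0,1)) satisfying M₁ ≤ u₀(x) ≤ M₂ for a.e. x ∈ (0,1). Then for all t ∈ [0,T], M₁ ≤ u(x,t) ≤ M₂ for a.e. x ∈ (0,1). -/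
open MeasureTheory Set ENNReal

instance mu01_prob : IsProbabilityMeasure mu01 :=
  ⟨by simp [mu01]⟩

theorem linf_ae_le (f : Lp ℝ ⊤ mu01) : ∀ᵐ x ∂mu01, |(f : ℝ → ℝ) x| ≤ ‖f‖ := by
  have h := enorm_ae_le_eLpNormEssSup (f : ℝ → ℝ) mu01
  filter_upwards [h] with x hx
  have hfin : eLpNorm (f : ℝ → ℝ) ⊤ mu01 ≠ ⊤ := Lp.eLpNorm_ne_top f
  rw [Lp.norm_def, ← Real.norm_eq_abs, ← toReal_enorm]
  exact ENNReal.toReal_mono hfin (by simpa [eLpNorm_exponent_top] using hx)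

theorem linf_le_of_ae (f : Lp ℝ ⊤ mu01) (C : ℝ) (hC : 0 ≤ C)
    (h : ∀ᵐ x ∂mu01, |(f : ℝ → ℝ) x| ≤ C) : ‖f‖ ≤ C := by
  have := Lp.norm_le_of_ae_bound (f := f) hC h
  simpa using this

/-- pointwise scalar inequality -/
theorem scalar_step (s m h K d ls p : ℝ) (hm : 0 ≤ m) (hs : s ≤ m) (hK : 0 ≤ K)
    (hh : 0 ≤ h) (hhK : h * (1 + K) ≤ 1) (hd1 : d ≤ 1)
    (hl : ls ≤ d * (m - s)) (hp : p ≤ K * |s|) :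
    s + h * (ls + p) ≤ (1 + h * K) * m := by
  have h1 : ls ≤ m - s := by nlinarith
  have h2 : h * (ls + p) ≤ h * (m - s + K * |s|) :=
    mul_le_mul_of_nonneg_left (by linarith) hh
  have hhK0 : 0 ≤ h * K := mul_nonneg hh hK
  rcases le_total 0 s with h0 | h0
  · rw [abs_of_nonneg h0] at h2
    nlinarith [mul_nonneg hhK0 (sub_nonneg.2 hs),
      mul_nonneg (sub_nonneg.2 (show h ≤ 1 by nlinarith)) (sub_nonneg.2 hs)]
  · rw [abs_of_nonpos h0] at h2
    nlinarith [mul_nonneg (sub_nonneg.2 hhK) (neg_nonneg.2 h0), mul_nonneg hhK0 hm,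
      mul_nonneg (sub_nonneg.2 (show h ≤ 1 by nlinarith)) hm]

theorem euler_step
    (W : ℝ → ℝ → ℝ) (hW : IsGraphon W)
    (Φ : ℝ → ℝ) (M₁ M₂ : ℝ) (hM : M₁ < M₂) (hΦM₂ : Φ M₂ ≤ 0) (hΦM₁ : 0 ≤ Φ M₁)
    (B : ℝ) (K : NNReal) (hK : LipschitzOnWith K Φ (Icc (-B) B))
    (hB1 : M₁ ∈ Icc (-B) B) (hB2 : M₂ ∈ Icc (-B) B)
    (L : Lp ℝ ⊤ mu01 →L[ℝ] Lp ℝ ⊤ mu01)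
    (hL : ∀ f : Lp ℝ ⊤ mu01, (L f : ℝ → ℝ) =ᵐ[mu01] graphonLap W f)
    (NΦ : Lp ℝ ⊤ mu01 → Lp ℝ ⊤ mu01)
    (hNΦ : ∀ f : Lp ℝ ⊤ mu01, (NΦ f : ℝ → ℝ) =ᵐ[mu01] fun x => Φ ((f : ℝ → ℝ) x))
    (f : Lp ℝ ⊤ mu01) (hfB : ‖f‖ ≤ B) (m : ℝ) (hm : 0 ≤ m)
    (hfm : ‖f - Lp.const ⊤ mu01 ((M₁ + M₂) / 2)‖ ≤ (M₂ - M₁) / 2 + m)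
    (h : ℝ) (hh : 0 ≤ h) (hhK : h * (1 + K) ≤ 1) :
    ‖f + h • (L f + NΦ f) - Lp.const ⊤ mu01 ((M₁ + M₂) / 2)‖
      ≤ (M₂ - M₁) / 2 + (1 + h * K) * m := by
  obtain ⟨hWm, -, hW0, hWi, hWd⟩ := hW
  have hK0 : (0:ℝ) ≤ K := K.2
  apply linf_le_of_ae
  · have : 0 ≤ (1 + h * K) * m := by positivity
    linarith
  have hfc : ∀ᵐ x ∂mu01, M₁ - m ≤ (f : ℝ → ℝ) x ∧ (f : ℝ → ℝ) x ≤ M₂ + m := by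
    filter_upwards [linf_ae_le (f - Lp.const ⊤ mu01 ((M₁ + M₂) / 2)),
      Lp.coeFn_sub f (Lp.const ⊤ mu01 ((M₁ + M₂) / 2)),
      Lp.coeFn_const ⊤ mu01 ((M₁ + M₂) / 2)] with x h1 h2 h3
    rw [h2, Pi.sub_apply, h3, Function.const_apply] at h1
    have := abs_le.1 (h1.trans hfm)
    constructor <;> linarith [this.1, this.2]
  have hfi : ∀ᵐ x ∂mu01, Integrable (fun y => W x y) mu01 := hWi.prod_right_ae
  filter_upwards [hfc, hfi, hWd, linf_ae_le f, hL f, hNΦ f,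
    Lp.coeFn_sub (f + h • (L f + NΦ f)) (Lp.const ⊤ mu01 ((M₁ + M₂) / 2)),
    Lp.coeFn_const ⊤ mu01 ((M₁ + M₂) / 2), Lp.coeFn_add f (h • (L f + NΦ f)),
    Lp.coeFn_smul h (L f + NΦ f), Lp.coeFn_add (L f) (NΦ f)]
    with x hx hWx hdx hxB hLx hNx e1 e2 e3 e4 e5
  rw [e1, Pi.sub_apply, e2, e3, Pi.add_apply, e4, Pi.smul_apply, e5, Pi.add_apply, hLx, hNx,
    smul_eq_mul, Function.const_apply]
  have hfx : (f : ℝ → ℝ) x ∈ Icc (-B) B := abs_le.1 (hxB.trans hfB)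
  have hint : Integrable (fun y => W x y * ((f : ℝ → ℝ) y - (f : ℝ → ℝ) x)) mu01 := by
    refine hWx.mul_bdd (c := 2 * B) ((Lp.aestronglyMeasurable f).sub aestronglyMeasurable_const) ?_
    filter_upwards [linf_ae_le f] with y hy
    have := abs_le.1 (hy.trans hfB)
    rw [Real.norm_eq_abs, abs_le]
    constructor <;> linarith [this.1, this.2, hfx.1, hfx.2]
  set a := (f : ℝ → ℝ) x with ha
  have hup : graphonLap W f x ≤ (∫ y, W x y ∂mu01) * (m - (a - M₂)) := by
    rw [← integral_mul_const]
    refine integral_mono_ae hint (hWx.mul_const _) ?_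
    filter_upwards [hfc] with y hy
    exact mul_le_mul_of_nonneg_left (by linarith [hy.2]) (hW0 x y)
  have hlo : -graphonLap W f x ≤ (∫ y, W x y ∂mu01) * (m - (M₁ - a)) := by
    rw [← integral_mul_const, graphonLap, ← integral_neg]
    refine integral_mono_ae hint.neg (hWx.mul_const _) ?_
    filter_upwards [hfc] with y hy
    have := mul_le_mul_of_nonneg_left (show a - (f : ℝ → ℝ) y ≤ m - (M₁ - a) by linarith [hy.1])
      (hW0 x y)
    change -(W x y * ((f : ℝ → ℝ) y - a)) ≤ W x y * (m - (M₁ - a))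
    linarith
  have hp2 : Φ a ≤ K * |a - M₂| := by
    have := hK.dist_le_mul a hfx M₂ hB2
    rw [Real.dist_eq, Real.dist_eq] at this
    linarith [le_abs_self (Φ a - Φ M₂)]
  have hp1 : -Φ a ≤ K * |M₁ - a| := by
    have := hK.dist_le_mul M₁ hB1 a hfx
    rw [Real.dist_eq, Real.dist_eq] at this
    linarith [le_abs_self (Φ M₁ - Φ a)]
  have r2 := scalar_step (a - M₂) m h K _ _ _ hm (by linarith [hx.2]) hK0 hh hhK hdx hup hp2
  have r1 := scalar_step (M₁ - a) m h K _ _ _ hm (by linarith [hx.1]) hK0 hh hhK hdx hlo hp1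
  rw [abs_le]
  constructor <;> linarith

/-- maximum bound principle for the graphon reaction–diffusion equation:
if Φ(0)=0, Φ is locally Lipschitz, Φ(M₂) ≤ 0 ≤ Φ(M₁) with M₁ < M₂, and the initial
datum satisfies M₁ ≤ u₀ ≤ M₂ a.e., then the classical solution satisfies
M₁ ≤ u(x,t) ≤ M₂ a.e. for every t ∈ [0,T]. -/
theorem graphonRD_maxPrinciple
    (W : ℝ → ℝ → ℝ) (hW : IsGraphon W)
    (Φ : ℝ → ℝ) (hΦ0 : Φ 0 = 0)
    (hΦlip : ∀ R : ℝ, 0 < R → ∃ K : NNReal, LipschitzOnWith K Φ (Icc (-R) R))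
    (M₁ M₂ : ℝ) (hM : M₁ < M₂) (hΦM₂ : Φ M₂ ≤ 0) (hΦM₁ : 0 ≤ Φ M₁)
    (T : ℝ) (hT : 0 < T)
    (L : Lp ℝ ⊤ mu01 →L[ℝ] Lp ℝ ⊤ mu01)
    (hL : ∀ f : Lp ℝ ⊤ mu01, (L f : ℝ → ℝ) =ᵐ[mu01] graphonLap W f)
    (NΦ : Lp ℝ ⊤ mu01 → Lp ℝ ⊤ mu01)
    (hNΦ : ∀ f : Lp ℝ ⊤ mu01, (NΦ f : ℝ → ℝ) =ᵐ[mu01] fun x => Φ ((f : ℝ → ℝ) x))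
    (u : ℝ → Lp ℝ ⊤ mu01)
    (hsol : ∀ t ∈ Icc (0:ℝ) T, HasDerivWithinAt u (L (u t) + NΦ (u t)) (Icc 0 T) t)
    (hinit : ∀ᵐ x ∂mu01, (u 0 : ℝ → ℝ) x ∈ Icc M₁ M₂) :
    ∀ t ∈ Icc (0:ℝ) T, ∀ᵐ x ∂mu01, (u t : ℝ → ℝ) x ∈ Icc M₁ M₂ := by
  set c := Lp.const ⊤ mu01 ((M₁ + M₂) / 2) with hc
  have hucont : ContinuousOn u (Icc 0 T) := fun t ht => (hsol t ht).continuousWithinAt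
  obtain ⟨B₀, hB₀⟩ := isCompact_Icc.exists_bound_of_continuousOn hucont
  set B := |B₀| + |M₁| + |M₂| + 1 with hBdef
  have hB : ∀ t ∈ Icc (0:ℝ) T, ‖u t‖ ≤ B := fun t ht => by
    linarith [hB₀ t ht, le_abs_self B₀, abs_nonneg M₁, abs_nonneg M₂]
  have hB1 : M₁ ∈ Icc (-B) B :=
    abs_le.1 (by linarith [abs_nonneg B₀, abs_nonneg M₁, abs_nonneg M₂])
  have hB2 : M₂ ∈ Icc (-B) B :=
    abs_le.1 (by linarith [abs_nonneg B₀, abs_nonneg M₁, abs_nonneg M₂])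
  obtain ⟨K, hK⟩ := hΦlip B (by positivity)
  have hK0 : (0:ℝ) ≤ K := K.2
  let g : ℝ → ℝ := fun t => max (‖u t - c‖ - (M₂ - M₁) / 2) 0
  have hg0 : ∀ t, 0 ≤ g t := fun t => le_max_right _ _
  have hg1 : ∀ t, ‖u t - c‖ ≤ (M₂ - M₁) / 2 + g t := fun t => by
    linarith [le_max_left (‖u t - c‖ - (M₂ - M₁) / 2) 0]
  have hgc : ContinuousOn g (Icc 0 T) :=
    (((hucont.sub continuousOn_const).norm).sub continuousOn_const).sup continuousOn_const
  have hginit : g 0 ≤ 0 := by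
    refine max_le ?_ le_rfl
    have : ‖u 0 - c‖ ≤ (M₂ - M₁) / 2 := by
      apply linf_le_of_ae _ _ (by linarith)
      filter_upwards [hinit, Lp.coeFn_sub (u 0) c, Lp.coeFn_const ⊤ mu01 ((M₁ + M₂) / 2)]
        with x h1 h2 h3
      rw [h2, Pi.sub_apply, h3, Function.const_apply, abs_le]
      constructor <;> linarith [h1.1, h1.2]
    linarith
  have key := le_gronwallBound_of_liminf_deriv_right_le (f := g) (f' := fun t => K * g t)
    (δ := 0) (K := K) (ε := 0) (a := 0) (b := T) hgc ?_ hginit (fun x _ => by simp)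
  · intro t ht
    have h1 := key t ht
    rw [gronwallBound_ε0_δ0] at h1
    filter_upwards [linf_ae_le (u t - c), Lp.coeFn_sub (u t) c,
      Lp.coeFn_const ⊤ mu01 ((M₁ + M₂) / 2)] with x h4 h2 h3
    rw [h2, Pi.sub_apply, h3, Function.const_apply] at h4
    have := abs_le.1 (h4.trans (hg1 t))
    constructor <;> linarith [this.1, this.2]
  · intro t ht r hr
    have htI : t ∈ Icc (0:ℝ) T := ⟨ht.1, ht.2.le⟩
    obtain ⟨ε, hε0, hε⟩ : ∃ ε : ℝ, 0 < ε ∧ K * g t + ε < r :=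
      ⟨(r - K * g t) / 2, by linarith, by linarith⟩
    have hd : HasDerivWithinAt u (L (u t) + NΦ (u t)) (Ioi t) t :=
      (hsol t htI).mono_of_mem_nhdsWithin
        (Filter.mem_of_superset (Ioo_mem_nhdsGT ht.2)
          (fun z hz => ⟨ht.1.trans hz.1.le, hz.2.le⟩))
    have hlo := (hasDerivWithinAt_iff_isLittleO.1 hd).def hε0
    have hsmall : ∀ᶠ z in nhdsWithin t (Ioi t), z < t + 1 / (1 + K) :=
      (eventually_lt_nhds (by linarith [show (0:ℝ) < 1 / (1 + K) by positivity])).filter_mono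
        nhdsWithin_le_nhds
    apply Filter.Eventually.frequently
    filter_upwards [hlo, hsmall, self_mem_nhdsWithin] with z hz1 hz2 hz3
    have hzt : 0 < z - t := sub_pos.2 hz3
    have hhK : (z - t) * (1 + K) ≤ 1 := by
      have : z - t ≤ 1 / (1 + K) := by linarith
      rwa [le_div_iff₀ (by positivity)] at this
    have hE := euler_step W hW Φ M₁ M₂ hM hΦM₂ hΦM₁ B K hK hB1 hB2 L hL NΦ hNΦ (u t) (hB t htI)
      (g t) (hg0 t) (hg1 t) (z - t) hzt.le hhK
    rw [← hc] at hE
    rw [Real.norm_of_nonneg hzt.le] at hz1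
    have htri : ‖u z - c‖ ≤ ‖u t + (z - t) • (L (u t) + NΦ (u t)) - c‖ + ε * (z - t) := by
      have e : u z - c = (u t + (z - t) • (L (u t) + NΦ (u t)) - c)
          + (u z - u t - (z - t) • (L (u t) + NΦ (u t))) := by abel
      rw [e]
      exact (norm_add_le _ _).trans (by linarith)
    have hgz : g z ≤ (1 + (z - t) * K) * g t + ε * (z - t) := by
      refine max_le (by linarith) ?_
      have := hg0 t
      positivity
    calc (z - t)⁻¹ * (g z - g t) ≤ (z - t)⁻¹ * ((z - t) * (K * g t + ε)) :=
          mul_le_mul_of_nonneg_left (by linarith) (by positivity)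
      _ = K * g t + ε := by field_simp
      _ < r := hε
end
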